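/- Let u ∈ S_n be a permutation with u(i) = n−2, u(n−1) = n, u(n) = n−1, where i < n−2. Let v = s_i = (i, i+1) and w = u·(i, n) (the transposition t_{i,n} acting on positions), and take bit scaling with respect to k = n−1. Then c^w_{u,v} = 1 and c^{N⊗w}_{N⊗u, N⊗v} = 0 for all N > 1. -/

import Mathlib

open scoped Classical

/-- `w` lies in (the copy of) `S_n`: it fixes every point `m ≥ n` (0-indexed). -/
def InSymm (n : ℕ) (w : Equiv.Perm ℕ) : Prop := ∀ m, n ≤ m → w m = m

/-- `w ∈ S_∞`: `w` fixes all but finitely many points. -/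
def IsFinPerm (w : Equiv.Perm ℕ) : Prop := ∃ n, InSymm n w

/-- `ℓ(w)`: the number of inversions of `w`. -/
noncomputable def invLen (w : Equiv.Perm ℕ) : ℕ :=
  Set.ncard {p : ℕ × ℕ | p.1 < p.2 ∧ w p.2 < w p.1}

/-- the Lehmer code of `w` (0-indexed): `lCode w i = #{j > i | w j < w i}`. -/
noncomputable def lCode (w : Equiv.Perm ℕ) (i : ℕ) : ℕ :=
  Set.ncard {j | i < j ∧ w j < w i}

/-- the descent set of `w` (0-indexed). -/
def des (w : Equiv.Perm ℕ) : Set ℕ := {i | w (i + 1) < w i}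

/-- the divided difference operator `∂ᵢ f = (f - sᵢ·f)/(xᵢ - xᵢ₊₁)`. -/
noncomputable def divDiff (i : ℕ) (f : MvPolynomial ℕ ℤ) : MvPolynomial ℕ ℤ :=
  if h : ∃ g, f - MvPolynomial.rename (Equiv.swap i (i + 1)) f =
      (MvPolynomial.X i - MvPolynomial.X (i + 1)) * g
  then h.choose else 0

/-- `𝔖_{w₀} = x₁^{n-1} x₂^{n-2} ⋯ x_{n-1}` (with variables 0-indexed). -/
noncomputable def staircase (n : ℕ) : MvPolynomial ℕ ℤ :=
  ∏ i ∈ Finset.range n, (MvPolynomial.X i : MvPolynomial ℕ ℤ) ^ (n - 1 - i)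

/-- Fuelled recursion computing Schubert polynomials inside `S_n`:
`𝔖_w = ∂ᵢ 𝔖_{w·sᵢ}` whenever `w i < w (i+1)`, starting from `𝔖_{w₀} = staircase n`. -/
noncomputable def SchubertAux (n : ℕ) : ℕ → Equiv.Perm ℕ → MvPolynomial ℕ ℤ
  | 0, _ => staircase n
  | (k + 1), w =>
    if h : ∃ i, i + 1 < n ∧ w i < w (i + 1) then
      divDiff h.choose (SchubertAux n k (w * Equiv.swap h.choose (h.choose + 1)))
    else staircase n

/-- the Schubert polynomial `𝔖_w` of `w ∈ S_∞`. -/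
noncomputable def Schubert (w : Equiv.Perm ℕ) : MvPolynomial ℕ ℤ :=
  if h : IsFinPerm w then SchubertAux h.choose (h.choose * h.choose) w else 0

/-- `c` is the family of Schubert coefficients `c^w_{u,v}` for the pair `(u,v)`, i.e. the
(finitely supported, `S_∞`-supported) coefficients with
`𝔖_u · 𝔖_v = Σ_{w ∈ S_∞} c^w_{u,v} 𝔖_w`. -/
def IsSchubertCoeff (u v : Equiv.Perm ℕ) (c : Equiv.Perm ℕ →₀ ℕ) : Prop :=
  (∀ w ∈ c.support, IsFinPerm w) ∧
  Schubert u * Schubert v = c.sum fun w k => (k : MvPolynomial ℕ ℤ) * Schubert w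

/-- `w'` is the code scaling `N ∗ w`: the unique permutation whose Lehmer code is
`N` times the Lehmer code of `w`. -/
def IsCodeScale (N : ℕ) (w w' : Equiv.Perm ℕ) : Prop :=
  IsFinPerm w' ∧ ∀ i, lCode w' i = N * lCode w i

/-- the Rothe diagram of `w` (0-indexed). -/
def rothe (w : Equiv.Perm ℕ) : Set (ℕ × ℕ) := {p | p.2 < w p.1 ∧ p.1 < w.symm p.2}

/-- column `h` of the Rothe diagram of `w`. -/
def rotheCol (w : Equiv.Perm ℕ) (h : ℕ) : Set ℕ := {r | (r, h) ∈ rothe w}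

/-- the shaded columns of `D(w)` with respect to `k`: the columns `w r` for rows `r > k`. -/
def shadedCols (k : ℕ) (w : Equiv.Perm ℕ) : Set ℕ := {j | ∃ r, k < r ∧ w r = j}

/-- the position at which (the copies of) column `j` start after every shaded column
is replaced by `N` adjacent copies of itself. -/
noncomputable def stretchCol (k N : ℕ) (w : Equiv.Perm ℕ) (j : ℕ) : ℕ :=
  Set.ncard {h | h < j ∧ h ∉ shadedCols k w} + N * Set.ncard {h | h < j ∧ h ∈ shadedCols k w}

/-- `w'` is the bit scaling `N ⊗ w` with respect to `k`: the unique permutation in `S_∞`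
whose Rothe diagram is obtained from `D(w)` by replacing each shaded column by `N`
adjacent copies of itself. -/
def IsBitScale (k N : ℕ) (w w' : Equiv.Perm ℕ) : Prop :=
  IsFinPerm w' ∧
  rothe w' = {q | ∃ p ∈ rothe w, ∃ m,
    m < (if p.2 ∈ shadedCols k w then N else 1) ∧ q = (p.1, stretchCol k N w p.2 + m)}

/-- `D(u)` together with a copy of `D(v)` shifted `m` columns to the right. -/
def doubleDiagram (m : ℕ) (u v : Equiv.Perm ℕ) : Set (ℕ × ℕ) :=
  rothe u ∪ {q | ∃ p ∈ rothe v, q = (p.1, p.2 + m)}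

/-- `T` is an indicator tableau in `Tab^w_{u,v}` (for `u, v, w ∈ S_m`, all 0-indexed):
a filling of `D(u) ∪ D(v)` with entries in `{0, …, m-1}` such that the number of entries
equal to `i` is `lCode w i`, entries strictly increase down each column, and every entry
appearing in row `r` is at most `r`. -/
def IsIndicatorTableau (m : ℕ) (u v w : Equiv.Perm ℕ) (T : ℕ × ℕ → ℕ) : Prop :=
  (∀ p ∈ doubleDiagram m u v, T p < m) ∧
  (∀ i < m, Set.ncard {p | p ∈ doubleDiagram m u v ∧ T p = i} = lCode w i) ∧
  (∀ p ∈ doubleDiagram m u v, ∀ q ∈ doubleDiagram m u v, p.2 = q.2 → p.1 < q.1 → T p < T q) ∧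
  (∀ p ∈ doubleDiagram m u v, T p ≤ p.1)

open MvPolynomial

/-- The divided difference exists: `xⱼ - xⱼ₊₁` divides `f - sⱼ·f`. -/
theorem exists_divDiff (j : ℕ) (f : MvPolynomial ℕ ℤ) :
    ∃ g, f - rename (Equiv.swap j (j + 1)) f = (X j - X (j + 1)) * g := by
  induction f using MvPolynomial.induction_on with
  | C a => exact ⟨0, by simp⟩
  | add p q hp hq =>
    obtain ⟨g, hg⟩ := hp
    obtain ⟨h, hh⟩ := hq
    exact ⟨g + h, by rw [map_add]; linear_combination hg + hh⟩
  | mul_X p k hp =>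
    obtain ⟨g, hg⟩ := hp
    have hX : ∃ h : MvPolynomial ℕ ℤ,
        X k - X (Equiv.swap j (j + 1) k) = (X j - X (j + 1)) * h := by
      rcases eq_or_ne k j with rfl | h1
      · exact ⟨1, by simp⟩
      rcases eq_or_ne k (j + 1) with rfl | h2
      · exact ⟨-1, by simp⟩
      · exact ⟨0, by simp [Equiv.swap_apply_of_ne_of_ne h1 h2]⟩
    obtain ⟨h, hh⟩ := hX
    refine ⟨g * X (Equiv.swap j (j + 1) k) + p * h, ?_⟩
    rw [map_mul, rename_X]
    linear_combination X (Equiv.swap j (j + 1) k) * hg + p * hh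

theorem mul_divDiff (j : ℕ) (f : MvPolynomial ℕ ℤ) :
    (X j - X (j + 1)) * divDiff j f = f - rename (Equiv.swap j (j + 1)) f := by
  have h := exists_divDiff j f
  rw [divDiff, dif_pos h]
  exact h.choose_spec.symm

theorem X_sub_X_ne_zero {a b : ℕ} (h : a ≠ b) :
    (X a - X b : MvPolynomial ℕ ℤ) ≠ 0 :=
  sub_ne_zero.2 fun hX => h (X_injective hX)

theorem divDiff_eq_of_mul_eq {j : ℕ} {f g : MvPolynomial ℕ ℤ}
    (h : (X j - X (j + 1)) * g = f - rename (Equiv.swap j (j + 1)) f) : divDiff j f = g :=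
  mul_left_cancel₀ (X_sub_X_ne_zero (Nat.succ_ne_self j).symm) ((mul_divDiff j f).trans h.symm)

theorem divDiff_add (j : ℕ) (f g : MvPolynomial ℕ ℤ) :
    divDiff j (f + g) = divDiff j f + divDiff j g :=
  divDiff_eq_of_mul_eq (by
    rw [map_add]; linear_combination mul_divDiff j f + mul_divDiff j g)

theorem divDiff_smul (j : ℕ) (a : ℤ) (f : MvPolynomial ℕ ℤ) :
    divDiff j (a • f) = a • divDiff j f :=
  divDiff_eq_of_mul_eq (by
    rw [map_zsmul, mul_smul_comm, mul_divDiff, smul_sub])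

/-- The divided difference operator as a `ℤ`-linear map. -/
noncomputable def divDiffLin (j : ℕ) : MvPolynomial ℕ ℤ →ₗ[ℤ] MvPolynomial ℕ ℤ where
  toFun := divDiff j
  map_add' := divDiff_add j
  map_smul' := divDiff_smul j

theorem divDiff_mul (j : ℕ) (f g : MvPolynomial ℕ ℤ) :
    divDiff j (f * g) =
      divDiff j f * g + rename (Equiv.swap j (j + 1)) f * divDiff j g :=
  divDiff_eq_of_mul_eq (by
    rw [map_mul]
    linear_combination g * mul_divDiff j f +
      rename (Equiv.swap j (j + 1)) f * mul_divDiff j g)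

theorem divDiff_C (j : ℕ) (a : ℤ) : divDiff j (C a) = 0 :=
  divDiff_eq_of_mul_eq (by simp)

theorem divDiff_eq_zero_iff {j : ℕ} {f : MvPolynomial ℕ ℤ} :
    divDiff j f = 0 ↔ rename (Equiv.swap j (j + 1)) f = f := by
  constructor
  · intro h
    have := mul_divDiff j f
    rw [h, mul_zero] at this
    exact (sub_eq_zero.1 this.symm).symm
  · intro h
    exact divDiff_eq_of_mul_eq (by rw [h]; simp)

theorem divDiff_X (j k : ℕ) :
    divDiff j (X k) = C ((if k = j then 1 else 0) - (if k = j + 1 then 1 else 0)) := by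
  apply divDiff_eq_of_mul_eq
  rw [rename_X]
  rcases eq_or_ne k j with rfl | h1
  · simp
  rcases eq_or_ne k (j + 1) with rfl | h2
  · simp
  · simp [h1, h2, Equiv.swap_apply_of_ne_of_ne h1 h2]

theorem rename_rename_swap (j : ℕ) (f : MvPolynomial ℕ ℤ) :
    rename (Equiv.swap j (j + 1)) (rename (Equiv.swap j (j + 1)) f) = f := by
  rw [rename_rename]
  convert rename_id_apply f
  ext x
  simp

theorem rename_divDiff (j : ℕ) (f : MvPolynomial ℕ ℤ) :
    rename (Equiv.swap j (j + 1)) (divDiff j f) = divDiff j f := by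
  symm
  apply divDiff_eq_of_mul_eq
  have h := congrArg (rename (Equiv.swap j (j + 1))) (mul_divDiff j f)
  simp only [map_mul, map_sub, rename_X, Equiv.swap_apply_left, Equiv.swap_apply_right,
    rename_rename_swap] at h
  linear_combination -h

theorem divDiff_divDiff (j : ℕ) (f : MvPolynomial ℕ ℤ) : divDiff j (divDiff j f) = 0 :=
  divDiff_eq_zero_iff.2 (rename_divDiff j f)

theorem divDiff_comm {i j : ℕ} (h : i + 1 < j) (f : MvPolynomial ℕ ℤ) :
    divDiff i (divDiff j f) = divDiff j (divDiff i f) := by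
  have hi : Equiv.swap j (j + 1) i = i := Equiv.swap_apply_of_ne_of_ne (by omega) (by omega)
  have hi' : Equiv.swap j (j + 1) (i + 1) = i + 1 :=
    Equiv.swap_apply_of_ne_of_ne (by omega) (by omega)
  have hj : Equiv.swap i (i + 1) j = j := Equiv.swap_apply_of_ne_of_ne (by omega) (by omega)
  have hj' : Equiv.swap i (i + 1) (j + 1) = j + 1 :=
    Equiv.swap_apply_of_ne_of_ne (by omega) (by omega)
  have hst : rename (Equiv.swap i (i + 1)) (rename (Equiv.swap j (j + 1)) f) =
      rename (Equiv.swap j (j + 1)) (rename (Equiv.swap i (i + 1)) f) := by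
    rw [rename_rename, rename_rename]
    congr 2
    ext x
    simp only [Function.comp, Equiv.swap_apply_def]
    grind
  have e1 := mul_divDiff i (divDiff j f)
  have e2 := mul_divDiff j (divDiff i f)
  have e3 := congrArg (rename (Equiv.swap i (i + 1))) (mul_divDiff j f)
  have e4 := congrArg (rename (Equiv.swap j (j + 1))) (mul_divDiff i f)
  simp only [map_mul, map_sub, rename_X, hi, hi', hj, hj'] at e3 e4
  apply mul_left_cancel₀ (X_sub_X_ne_zero (Nat.succ_ne_self i).symm)
  apply mul_left_cancel₀ (X_sub_X_ne_zero (Nat.succ_ne_self j).symm)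
  linear_combination (X j - X (j + 1)) * e1 - (X i - X (i + 1)) * e2 - e3 + e4 +
    mul_divDiff j f - mul_divDiff i f + hst

theorem divDiff_braid (i : ℕ) (f : MvPolynomial ℕ ℤ) :
    divDiff i (divDiff (i + 1) (divDiff i f)) =
      divDiff (i + 1) (divDiff i (divDiff (i + 1) f)) := by
  have h1 : Equiv.swap i (i + 1) (i + 2) = i + 2 :=
    Equiv.swap_apply_of_ne_of_ne (by omega) (by omega)
  have h2 : Equiv.swap (i + 1) (i + 2) i = i :=
    Equiv.swap_apply_of_ne_of_ne (by omega) (by omega)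
  have hsts : rename (Equiv.swap i (i + 1)) (rename (Equiv.swap (i + 1) (i + 2))
        (rename (Equiv.swap i (i + 1)) f)) =
      rename (Equiv.swap (i + 1) (i + 2)) (rename (Equiv.swap i (i + 1))
        (rename (Equiv.swap (i + 1) (i + 2)) f)) := by
    simp only [rename_rename]
    congr 2
    ext x
    simp only [Function.comp, Equiv.swap_apply_def]
    grind
  set s := rename (R := ℤ) (Equiv.swap i (i + 1)) with hs
  set t := rename (R := ℤ) (Equiv.swap (i + 1) (i + 2)) with ht
  have ds : ∀ g, (X i - X (i + 1)) * divDiff i g = g - s g := mul_divDiff i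
  have dt : ∀ g, (X (i + 1) - X (i + 2)) * divDiff (i + 1) g = g - t g := mul_divDiff (i + 1)
  have sX : s (X i) = X (i + 1) ∧ s (X (i + 1)) = X i ∧ s (X (i + 2)) = X (i + 2) := by
    simp [hs, rename_X, h1]
  have tX : t (X i) = X i ∧ t (X (i + 1)) = X (i + 2) ∧ t (X (i + 2)) = X (i + 1) := by
    simp [ht, rename_X, h2]
  have rs : ∀ g, s (divDiff i g) = divDiff i g := rename_divDiff i
  have rt : ∀ g, t (divDiff (i + 1) g) = divDiff (i + 1) g := rename_divDiff (i + 1)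
  obtain ⟨s0, s1, s2⟩ := sX
  obtain ⟨t0, t1, t2⟩ := tX
  have key1 : (X i - X (i + 1)) * ((X (i + 1) - X (i + 2)) * ((X i - X (i + 2)) *
      divDiff i (divDiff (i + 1) (divDiff i f)))) =
      f - s f - t f + t (s f) + s (t f) - s (t (s f)) := by
    have a1 := congrArg s (dt (divDiff i f))
    have a2 := congrArg t (ds f)
    have a3 := congrArg s a2
    simp only [map_mul, map_sub, s0, s1, s2, t0, t1, rs] at a1 a2 a3
    linear_combination (X (i + 1) - X (i + 2)) * (X i - X (i + 2)) *
      ds (divDiff (i + 1) (divDiff i f)) + (X i - X (i + 2)) * dt (divDiff i f) -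
      (X (i + 1) - X (i + 2)) * a1 - a2 + a3 + ds f
  have key2 : (X i - X (i + 1)) * ((X (i + 1) - X (i + 2)) * ((X i - X (i + 2)) *
      divDiff (i + 1) (divDiff i (divDiff (i + 1) f)))) =
      f - s f - t f + t (s f) + s (t f) - t (s (t f)) := by
    have a1 := congrArg t (ds (divDiff (i + 1) f))
    have a2 := congrArg s (dt f)
    have a3 := congrArg t a2
    simp only [map_mul, map_sub, s1, s2, t0, t1, t2, rt] at a1 a2 a3
    linear_combination (X i - X (i + 1)) * (X i - X (i + 2)) *
      dt (divDiff i (divDiff (i + 1) f)) + (X i - X (i + 2)) * ds (divDiff (i + 1) f) -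
      (X i - X (i + 1)) * a1 - a2 + a3 + dt f
  apply mul_left_cancel₀ (X_sub_X_ne_zero (show i ≠ i + 2 by omega))
  apply mul_left_cancel₀ (X_sub_X_ne_zero (show i + 1 ≠ i + 2 by omega))
  apply mul_left_cancel₀ (X_sub_X_ne_zero (show i ≠ i + 1 by omega))
  rw [key1, key2, hsts]

theorem isHomogeneous_divDiff_monomial (j : ℕ) (m : ℕ →₀ ℕ) (a : ℤ) :
    ∃ d, (monomial m a).IsHomogeneous d ∧ (divDiff j (monomial m a)).IsHomogeneous (d - 1) ∧
      (d = 0 → divDiff j (monomial m a) = 0) := by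
  refine induction_on_monomial (motive := fun p => ∃ d, p.IsHomogeneous d ∧
    (divDiff j p).IsHomogeneous (d - 1) ∧ (d = 0 → divDiff j p = 0)) ?_ ?_ m a
  · intro a
    exact ⟨0, isHomogeneous_C _ _, by rw [divDiff_C]; exact isHomogeneous_zero _ _ _,
      fun _ => divDiff_C _ _⟩
  · rintro p k ⟨d, h1, h2, h3⟩
    refine ⟨d + 1, h1.mul (isHomogeneous_X _ _), ?_, by simp⟩
    rw [divDiff_mul, divDiff_X]
    refine IsHomogeneous.add ?_ ?_
    · rcases Nat.eq_zero_or_pos d with h | h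
      · rw [h3 h, zero_mul]
        exact isHomogeneous_zero _ _ _
      · have := h2.mul (isHomogeneous_X ℤ k)
        rwa [show d - 1 + 1 = d + 1 - 1 by omega] at this
    · exact (h1.rename_isHomogeneous).mul (isHomogeneous_C _ _)

theorem isHomogeneous_divDiff {j d : ℕ} {f : MvPolynomial ℕ ℤ} (hf : f.IsHomogeneous d) :
    (divDiff j f).IsHomogeneous (d - 1) := by
  have h : divDiff j f = ∑ m ∈ f.support, divDiff j (monomial m (f.coeff m)) := by
    conv_lhs => rw [f.as_sum]
    exact map_sum (divDiffLin j) _ _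
  rw [h]
  refine IsHomogeneous.sum _ _ _ fun m hm => ?_
  obtain ⟨e, he, he', -⟩ := isHomogeneous_divDiff_monomial j m (f.coeff m)
  have hne : f.coeff m ≠ 0 := mem_support_iff.1 hm
  have h1 : m.degree = e := he.degree_eq_sum_deg_support (by simp [hne]) |>.symm
  have h2 : m.degree = d := (hf.degree_eq_sum_deg_support hm).symm
  rwa [← h2, h1]

theorem divDiff_of_isHomogeneous_zero {j : ℕ} {f : MvPolynomial ℕ ℤ} (hf : f.IsHomogeneous 0) :
    divDiff j f = 0 := by
  rw [(totalDegree_eq_zero_iff_eq_C (p := f)).1 ((totalDegree_zero_iff_isHomogeneous ℕ).2 hf),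
    divDiff_C]

/-- A polynomial killed by every divided difference is constant. -/
theorem eq_C_of_divDiff_eq_zero {f : MvPolynomial ℕ ℤ} (h : ∀ j, divDiff j f = 0) :
    f = C (f.coeff 0) := by
  rw [← vars_eq_empty_iff_eq_C, ← Finset.not_nonempty_iff_eq_empty]
  intro hne
  have hmem := f.vars.max'_mem hne
  set k := f.vars.max' hne with hk
  have hr := divDiff_eq_zero_iff.1 (h k)
  rw [← hr] at hmem
  obtain ⟨i, hi, hik⟩ := mem_vars_rename _ _ hmem
  have : i = k + 1 := by
    rw [← Equiv.swap_apply_self k (k + 1) i, hik, Equiv.swap_apply_left]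
  have hle := f.vars.le_max' i hi
  omega

theorem InSymm.mono {n m : ℕ} {w : Equiv.Perm ℕ} (h : InSymm n w) (hnm : n ≤ m) : InSymm m w :=
  fun k hk => h k (hnm.trans hk)

theorem InSymm.lt {n k : ℕ} {w : Equiv.Perm ℕ} (h : InSymm n w) (hk : k < n) : w k < n := by
  by_contra! hc
  have := w.injective (h (w k) hc)
  omega

theorem InSymm.mul_swap {n a b : ℕ} {w : Equiv.Perm ℕ} (h : InSymm n w) (ha : a < n)
    (hb : b < n) : InSymm n (w * Equiv.swap a b) := fun k hk => by
  rw [Equiv.Perm.mul_apply, Equiv.swap_apply_of_ne_of_ne (by omega) (by omega), h k hk]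

theorem isFinPerm_swap (a b : ℕ) : IsFinPerm (Equiv.swap a b) :=
  ⟨a + b + 1, fun k hk => Equiv.swap_apply_of_ne_of_ne (by omega) (by omega)⟩

theorem IsFinPerm.mul_swap {w : Equiv.Perm ℕ} (h : IsFinPerm w) (a b : ℕ) :
    IsFinPerm (w * Equiv.swap a b) := by
  obtain ⟨n, hn⟩ := h
  exact ⟨n + a + b + 1, (hn.mono (by omega)).mul_swap (by omega) (by omega)⟩

theorem mem_rothe_apply {w : Equiv.Perm ℕ} {r d : ℕ} :
    (r, w d) ∈ rothe w ↔ w d < w r ∧ r < d := by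
  simp [rothe]

theorem rothe_subset {n : ℕ} {w : Equiv.Perm ℕ} (h : InSymm n w) :
    rothe w ⊆ (Finset.range n ×ˢ Finset.range n : Finset (ℕ × ℕ)) := by
  rintro ⟨r, c⟩ hp
  obtain ⟨d, rfl⟩ := w.surjective c
  rw [mem_rothe_apply] at hp
  have hr : r < n := by
    by_contra! hr
    have := h r hr
    have := h d (by omega)
    omega
  have := h.lt hr
  simp only [Finset.coe_product, Finset.coe_range, Set.mem_prod, Set.mem_Iio]
  omega

theorem rothe_finite {w : Equiv.Perm ℕ} (h : IsFinPerm w) : (rothe w).Finite := by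
  obtain ⟨n, hn⟩ := h
  exact (Finset.finite_toSet _).subset (rothe_subset hn)

theorem ncard_rothe_le {n : ℕ} {w : Equiv.Perm ℕ} (h : InSymm n w) :
    (rothe w).ncard ≤ n * n := by
  refine (Set.ncard_le_ncard (rothe_subset h) (Finset.finite_toSet _)).trans ?_
  rw [Set.ncard_coe_finset]
  simp

/-- Removing a descent at `j` removes exactly one box from the Rothe diagram. -/
theorem ncard_rothe_of_descent {w : Equiv.Perm ℕ} (h : IsFinPerm w) {j : ℕ}
    (hj : w (j + 1) < w j) :
    (rothe w).ncard = (rothe (w * Equiv.swap j (j + 1))).ncard + 1 := by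
  set s := Equiv.swap j (j + 1) with hs
  have hinj : Function.Injective (fun p : ℕ × ℕ => (s p.1, p.2)) := by
    rintro ⟨a, b⟩ ⟨c, d⟩ h
    simpa using h
  have key : rothe w = insert (j, w (j + 1))
      ((fun p : ℕ × ℕ => (s p.1, p.2)) '' rothe (w * s)) := by
    ext ⟨r, c⟩
    obtain ⟨d, rfl⟩ := w.surjective c
    have himg : (r, w d) ∈ (fun p : ℕ × ℕ => (s p.1, p.2)) '' rothe (w * s) ↔
        (w d < w r ∧ s r < s d) := by
      have : (r, w d) = (fun p : ℕ × ℕ => (s p.1, p.2)) (s r, (w * s) (s d)) := by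
        simp [hs]
      rw [this, hinj.mem_set_image, mem_rothe_apply]
      simp [hs]
    rw [Set.mem_insert_iff, himg, mem_rothe_apply, Prod.mk.injEq, w.injective.eq_iff, hs,
      Equiv.swap_apply_def, Equiv.swap_apply_def]
    grind
  have hnot : (j, w (j + 1)) ∉ (fun p : ℕ × ℕ => (s p.1, p.2)) '' rothe (w * s) := by
    have : (j, w (j + 1)) = (fun p : ℕ × ℕ => (s p.1, p.2)) (j + 1, (w * s) j) := by
      simp [hs]
    rw [this, hinj.mem_set_image, mem_rothe_apply]
    omega
  rw [key, Set.ncard_insert_of_notMem hnot ((rothe_finite (h.mul_swap _ _)).image _),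
    Set.ncard_image_of_injective _ hinj]

theorem ncard_rothe_of_ascent {w : Equiv.Perm ℕ} (h : IsFinPerm w) {j : ℕ}
    (hj : w j < w (j + 1)) :
    (rothe (w * Equiv.swap j (j + 1))).ncard = (rothe w).ncard + 1 := by
  have := ncard_rothe_of_descent (h.mul_swap j (j + 1)) (j := j) (by simpa using hj)
  rwa [mul_assoc, Equiv.swap_mul_self, mul_one] at this

theorem exists_descent {w : Equiv.Perm ℕ} (hw : w ≠ 1) : ∃ j, w (j + 1) < w j := by
  by_contra! h
  apply hw
  have hm : StrictMono w := strictMono_nat_of_lt_succ fun k =>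
    lt_of_le_of_ne (h k) fun he => by simpa using w.injective he
  have hm' : StrictMono w.symm := fun a b hab => by
    by_contra! hc
    have := hm.monotone hc
    simp only [Equiv.apply_symm_apply] at this
    omega
  ext k
  have h1 := hm.le_apply (x := k)
  have h2 := hm'.le_apply (x := w k)
  rw [Equiv.symm_apply_apply] at h2
  exact le_antisymm h2 h1

theorem rothe_one : rothe 1 = ∅ := by
  refine Set.eq_empty_of_forall_notMem ?_
  rintro ⟨r, c⟩ ⟨h1, h2⟩
  exact lt_asymm (show c < r from h1) h2

/-- `w · t_{ab}` is covered by `w` in the Bruhat order. -/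
def IsBruhatCover (w : Equiv.Perm ℕ) (a b : ℕ) : Prop :=
  a < b ∧ w b < w a ∧ ∀ c, a < c → c < b → ¬(w b < w c ∧ w c < w a)

theorem IsBruhatCover.descent {w : Equiv.Perm ℕ} {a b j : ℕ} (h : IsBruhatCover w a b)
    (hj : w (j + 1) < w j) (hne : ¬(a = j ∧ b = j + 1)) :
    (w * Equiv.swap a b) (j + 1) < (w * Equiv.swap a b) j := by
  obtain ⟨hab, hw, hc⟩ := h
  have h1 := hc j
  have h2 := hc (j + 1)
  have i1 : ∀ x y, w x = w y → x = y := fun x y h => w.injective h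
  simp only [Equiv.Perm.mul_apply, Equiv.swap_apply_def]
  grind

theorem IsBruhatCover.mul_swap {w : Equiv.Perm ℕ} {a b j : ℕ} (h : IsBruhatCover w a b)
    (hj : w (j + 1) < w j) (hne : ¬(a = j ∧ b = j + 1)) :
    IsBruhatCover (w * Equiv.swap j (j + 1)) (Equiv.swap j (j + 1) a)
      (Equiv.swap j (j + 1) b) := by
  obtain ⟨hab, hw, hc⟩ := h
  refine ⟨?_, by simpa using hw, ?_⟩
  · simp only [Equiv.swap_apply_def]
    grind
  · intro c h1 h2
    have h3 := hc (Equiv.swap j (j + 1) c)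
    simp only [Equiv.Perm.mul_apply, Equiv.swap_apply_self]
    simp only [Equiv.swap_apply_def] at h1 h2 h3 ⊢
    grind

theorem mul_swap_mul_swap_conj (w : Equiv.Perm ℕ) (a b j : ℕ) :
    w * Equiv.swap a b * Equiv.swap j (j + 1) =
      w * Equiv.swap j (j + 1) *
        Equiv.swap (Equiv.swap j (j + 1) a) (Equiv.swap j (j + 1) b) := by
  rw [mul_assoc, mul_assoc, Equiv.mul_swap_eq_swap_mul (Equiv.swap j (j + 1)),
    Equiv.swap_apply_self, Equiv.swap_apply_self]

/-- The Schubert polynomial of `w ∈ S_n`, computed inside `S_n`. -/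
noncomputable def schubertIn (n : ℕ) (w : Equiv.Perm ℕ) : MvPolynomial ℕ ℤ :=
  SchubertAux n (n * n - (rothe w).ncard) w

theorem colength_mul_swap {n i : ℕ} {w : Equiv.Perm ℕ} (hw : InSymm n w) (hi : i + 1 < n)
    (h : w i < w (i + 1)) :
    n * n - (rothe w).ncard =
      n * n - (rothe (w * Equiv.swap i (i + 1))).ncard + 1 := by
  have h1 := ncard_rothe_of_ascent ⟨n, hw⟩ h
  have h2 := ncard_rothe_le (hw.mul_swap (a := i) (b := i + 1) (by omega) hi)
  omega

theorem schubertAux_eq_aux (n : ℕ) : ∀ m : ℕ, ∀ w, InSymm n w → n * n - (rothe w).ncard = m →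
    (∀ k, m ≤ k → SchubertAux n k w = schubertIn n w) ∧
    ∀ i, i + 1 < n → w i < w (i + 1) →
      schubertIn n w = divDiff i (schubertIn n (w * Equiv.swap i (i + 1))) := by
  intro m
  induction m using Nat.strong_induction_on with
  | _ m ih =>
    intro w hw hm
    have step : ∀ w', InSymm n w' → n * n - (rothe w').ncard < m →
        ∀ i, i + 1 < n → w' i < w' (i + 1) →
        schubertIn n w' = divDiff i (schubertIn n (w' * Equiv.swap i (i + 1))) :=
      fun w' hw' hlt => (ih _ hlt w' hw' rfl).2
    have lower : ∀ i, i + 1 < n → w i < w (i + 1) →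
        n * n - (rothe (w * Equiv.swap i (i + 1))).ncard < m := fun i hi ha => by
      have := colength_mul_swap hw hi ha
      omega
    have indep : ∀ i j, i < j → j + 1 < n → w i < w (i + 1) → w j < w (j + 1) →
        divDiff i (schubertIn n (w * Equiv.swap i (i + 1))) =
          divDiff j (schubertIn n (w * Equiv.swap j (j + 1))) := by
      intro i j hij hj hai haj
      have hwi := hw.mul_swap (a := i) (b := i + 1) (by omega) (by omega)
      have hwj := hw.mul_swap (a := j) (b := j + 1) (by omega) (by omega)
      rcases Nat.lt_or_ge (i + 1) j with h | h
      · rw [step _ hwi (lower i (by omega) hai) j hj, step _ hwj (lower j hj haj) i (by omega),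
          divDiff_comm h, mul_swap_mul_swap_conj w j (j + 1) i]
        · rw [Equiv.swap_apply_of_ne_of_ne (by omega) (by omega),
            Equiv.swap_apply_of_ne_of_ne (by omega) (by omega),
            mul_swap_mul_swap_conj w i (i + 1) j,
            Equiv.swap_apply_of_ne_of_ne (by omega) (by omega),
            Equiv.swap_apply_of_ne_of_ne (by omega) (by omega)]
        · simp only [Equiv.Perm.mul_apply, Equiv.swap_apply_def]
          grind
        · simp only [Equiv.Perm.mul_apply, Equiv.swap_apply_def]
          grind
      · obtain rfl : j = i + 1 := by omega
        have hwij := hwi.mul_swap (a := i + 1) (b := i + 1 + 1) (by omega) (by omega)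
        have hwji := hwj.mul_swap (a := i) (b := i + 1) (by omega) (by omega)
        have a1 : (w * Equiv.swap i (i + 1)) (i + 1) <
            (w * Equiv.swap i (i + 1)) (i + 1 + 1) := by
          simp only [Equiv.Perm.mul_apply, Equiv.swap_apply_def]
          grind
        have a2 : (w * Equiv.swap (i + 1) (i + 1 + 1)) i <
            (w * Equiv.swap (i + 1) (i + 1 + 1)) (i + 1) := by
          simp only [Equiv.Perm.mul_apply, Equiv.swap_apply_def]
          grind
        have l1 := lower i (by omega) hai
        have l2 := lower (i + 1) hj haj
        have l3 := colength_mul_swap hwi hj a1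
        have l4 := colength_mul_swap hwj (by omega) a2
        rw [step _ hwi l1 (i + 1) hj a1, step _ hwj l2 i (by omega) a2,
          step _ hwij (by omega) i (by omega), step _ hwji (by omega) (i + 1) hj,
          divDiff_braid]
        · congr 4
          ext x
          simp only [Equiv.Perm.mul_apply]
          congr 1
          simp only [Equiv.swap_apply_def]
          grind
        · simp only [Equiv.Perm.mul_apply, Equiv.swap_apply_def]
          grind
        · simp only [Equiv.Perm.mul_apply, Equiv.swap_apply_def]
          grind
    have indep' : ∀ i j, i + 1 < n → j + 1 < n → w i < w (i + 1) → w j < w (j + 1) →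
        divDiff i (schubertIn n (w * Equiv.swap i (i + 1))) =
          divDiff j (schubertIn n (w * Equiv.swap j (j + 1))) := by
      intro i j hi hj hai haj
      rcases lt_trichotomy i j with h | rfl | h
      · exact indep i j h hj hai haj
      · rfl
      · exact (indep j i h hi haj hai).symm
    have main : ∀ k, m ≤ k → ∀ i, i + 1 < n → w i < w (i + 1) →
        SchubertAux n k w = divDiff i (schubertIn n (w * Equiv.swap i (i + 1))) := by
      intro k hk i hi ha
      obtain ⟨k, rfl⟩ : ∃ k', k = k' + 1 := ⟨k - 1, by have := lower i hi ha; omega⟩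
      have hex : ∃ i, i + 1 < n ∧ w i < w (i + 1) := ⟨i, hi, ha⟩
      rw [SchubertAux, dif_pos hex]
      obtain ⟨hj, haj⟩ := hex.choose_spec
      have hl := lower _ hj haj
      rw [(ih _ hl _ (hw.mul_swap (by omega) (by omega)) rfl).1 k (by omega)]
      exact indep' _ _ hj hi haj ha
    refine ⟨fun k hk => ?_, fun i hi ha => main _ hm.ge i hi ha⟩
    by_cases hex : ∃ i, i + 1 < n ∧ w i < w (i + 1)
    · obtain ⟨i, hi, ha⟩ := hex
      rw [main k hk i hi ha]
      exact (main _ hm.ge i hi ha).symm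
    · have : ∀ k, SchubertAux n k w = staircase n := by
        rintro (_ | k)
        · rfl
        · rw [SchubertAux, dif_neg hex]
      rw [schubertIn, this, this]

theorem schubertIn_of_ascent {n i : ℕ} {w : Equiv.Perm ℕ} (hw : InSymm n w) (hi : i + 1 < n)
    (h : w i < w (i + 1)) :
    schubertIn n w = divDiff i (schubertIn n (w * Equiv.swap i (i + 1))) :=
  (schubertAux_eq_aux n _ w hw rfl).2 i hi h

theorem schubertIn_of_no_ascent {n : ℕ} {w : Equiv.Perm ℕ}
    (h : ¬∃ i, i + 1 < n ∧ w i < w (i + 1)) : schubertIn n w = staircase n := by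
  rw [schubertIn]
  cases n * n - (rothe w).ncard with
  | zero => rfl
  | succ k => rw [SchubertAux, dif_neg h]

/-- The monomials interpolating between the staircases of `S_{n+1}` and `S_n`. -/
theorem schubertIn_succ_interpolation (n : ℕ) : ∀ k ≤ n, ∀ w, InSymm (n + 1) w → w k = n →
    (∀ a b, a < b → b ≤ n → a ≠ k → b ≠ k → w b < w a) →
    schubertIn (n + 1) w = ∏ i ∈ Finset.range (n + 1),
      (X i : MvPolynomial ℕ ℤ) ^ (if i < k then n - 1 - i else n - i) := by
  intro k
  induction k with
  | zero =>
    intro _ w hw h0 hd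
    rw [schubertIn_of_no_ascent]
    · simp [staircase]
    · rintro ⟨i, hi, ha⟩
      have := hw.lt hi
      rcases Nat.eq_zero_or_pos i with rfl | h
      · omega
      · have := hd i (i + 1) (by omega) (by omega) (by omega) (by omega)
        omega
  | succ k ih =>
    intro hk w hw h0 hd
    have hne : w k ≠ w (k + 1) := fun h => by simpa using w.injective h
    have hwk := hw.lt (show k < n + 1 by omega)
    have ha : w k < w (k + 1) := by omega
    rw [schubertIn_of_ascent hw (by omega) ha,
      ih (by omega) _ (hw.mul_swap (by omega) (by omega)) (by simpa using h0)]
    · set g := ∏ i ∈ Finset.range (n + 1),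
        (X i : MvPolynomial ℕ ℤ) ^ (if i < k + 1 then n - 1 - i else n - i) with hg
      have h1 : ∏ i ∈ Finset.range (n + 1),
          (X i : MvPolynomial ℕ ℤ) ^ (if i < k then n - 1 - i else n - i) = X k * g := by
        have hmem : k ∈ Finset.range (n + 1) := Finset.mem_range.2 (by omega)
        rw [hg, ← Finset.mul_prod_erase _ _ hmem, ← Finset.mul_prod_erase _ _ hmem,
          if_neg (lt_irrefl k), if_pos (Nat.lt_succ_self k), ← mul_assoc, ← pow_succ',
          show n - 1 - k + 1 = n - k by omega]
        congr 1
        refine Finset.prod_congr rfl fun i hi => ?_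
        have := Finset.ne_of_mem_erase hi
        congr 1
        split_ifs <;> omega
      have h2 : rename (Equiv.swap k (k + 1)) g = g := by
        rw [hg, map_prod]
        refine Finset.prod_equiv (Equiv.swap k (k + 1)) ?_ ?_
        · intro i
          simp only [Finset.mem_range, Equiv.swap_apply_def]
          split_ifs <;> omega
        · intro i _
          rw [map_pow, rename_X]
          congr 1
          simp only [Equiv.swap_apply_def]
          split_ifs <;> omega
      rw [h1]
      apply divDiff_eq_of_mul_eq
      rw [map_mul, h2, rename_X, Equiv.swap_apply_left]
      ring
    · intro a b hab hb hak hbk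
      have e1 := hd a b
      have e2 := hd k b
      have e3 := hd a k
      clear hd ih
      simp only [Equiv.Perm.mul_apply, Equiv.swap_apply_def]
      grind

theorem schubertIn_succ {n : ℕ} {w : Equiv.Perm ℕ} (hw : InSymm n w) :
    schubertIn (n + 1) w = schubertIn n w := by
  induction hm : n * n - (rothe w).ncard using Nat.strong_induction_on generalizing w with
  | _ m ih =>
    by_cases hex : ∃ i, i + 1 < n ∧ w i < w (i + 1)
    · obtain ⟨i, hi, ha⟩ := hex
      have := colength_mul_swap hw hi ha
      rw [schubertIn_of_ascent hw hi ha,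
        schubertIn_of_ascent (hw.mono n.le_succ) (by omega) ha,
        ih _ (by omega) (hw.mul_swap (by omega) (by omega)) rfl]
    · rw [schubertIn_of_no_ascent hex, schubertIn_succ_interpolation n n le_rfl w
        (hw.mono n.le_succ) (hw n le_rfl), staircase, Finset.prod_range_succ]
      · simp only [lt_irrefl, if_false, Nat.sub_self, pow_zero, mul_one]
        refine Finset.prod_congr rfl fun i hi => ?_
        rw [if_pos (Finset.mem_range.1 hi)]
      · intro a b hab hb _ hbn
        push Not at hex
        clear ih hm
        obtain ⟨d, rfl⟩ : ∃ d, b = a + 1 + d := ⟨b - a - 1, by omega⟩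
        have step : ∀ i, i + 1 < n → w (i + 1) < w i := fun i hi =>
          lt_of_le_of_ne (hex i hi) fun h => by simpa using w.injective h
        induction d with
        | zero => exact step a (by omega)
        | succ d ihd =>
          exact (step (a + 1 + d) (by omega)).trans
            (ihd (by omega) (by omega) (by omega))

theorem schubertIn_eq_of_le {n m : ℕ} {w : Equiv.Perm ℕ} (hw : InSymm n w) (h : n ≤ m) :
    schubertIn m w = schubertIn n w := by
  induction m, h using Nat.le_induction with
  | base => rfl
  | succ m hnm ih => rw [schubertIn_succ (hw.mono hnm), ih]

theorem schubert_eq_schubertIn {n : ℕ} {w : Equiv.Perm ℕ} (hw : InSymm n w) :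
    Schubert w = schubertIn n w := by
  have h : IsFinPerm w := ⟨n, hw⟩
  rw [Schubert, dif_pos h, (schubertAux_eq_aux _ _ w h.choose_spec rfl).1 _ (Nat.sub_le _ _)]
  rcases le_total n h.choose with hle | hle
  · exact schubertIn_eq_of_le hw hle
  · exact (schubertIn_eq_of_le h.choose_spec hle).symm

theorem divDiff_schubert_of_descent {w : Equiv.Perm ℕ} (hw : IsFinPerm w) {j : ℕ}
    (h : w (j + 1) < w j) : divDiff j (Schubert w) = Schubert (w * Equiv.swap j (j + 1)) := by
  obtain ⟨n, hn⟩ := hw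
  have hn' := hn.mono (show n ≤ n + j + 2 by omega)
  have hs := hn'.mul_swap (a := j) (b := j + 1) (by omega) (by omega)
  rw [schubert_eq_schubertIn hn', schubert_eq_schubertIn hs,
    schubertIn_of_ascent hs (i := j) (by omega) (by simpa using h), mul_assoc,
    Equiv.swap_mul_self, mul_one]

theorem divDiff_schubert_of_ascent {w : Equiv.Perm ℕ} (hw : IsFinPerm w) {j : ℕ}
    (h : w j < w (j + 1)) : divDiff j (Schubert w) = 0 := by
  have := divDiff_schubert_of_descent (hw.mul_swap j (j + 1)) (j := j) (by simpa using h)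
  rw [mul_assoc, Equiv.swap_mul_self, mul_one] at this
  rw [← this, divDiff_divDiff]

theorem schubert_one : Schubert 1 = 1 := by
  have h : InSymm 0 (1 : Equiv.Perm ℕ) := fun _ _ => rfl
  rw [schubert_eq_schubertIn h, schubertIn_of_no_ascent (by simp)]
  simp [staircase]

theorem exists_isHomogeneous_schubertIn {n : ℕ} {w : Equiv.Perm ℕ} (hw : InSymm n w) :
    ∃ d, (schubertIn n w).IsHomogeneous d := by
  induction hm : n * n - (rothe w).ncard using Nat.strong_induction_on generalizing w with
  | _ m ih =>
    by_cases hex : ∃ i, i + 1 < n ∧ w i < w (i + 1)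
    · obtain ⟨i, hi, ha⟩ := hex
      have := colength_mul_swap hw hi ha
      rw [schubertIn_of_ascent hw hi ha]
      obtain ⟨d, hd⟩ := ih _ (by omega) (hw.mul_swap (a := i) (b := i + 1) (by omega) hi) rfl
      exact ⟨_, isHomogeneous_divDiff hd⟩
    · rw [schubertIn_of_no_ascent hex, staircase]
      exact ⟨_, IsHomogeneous.prod _ _ _ fun i _ => isHomogeneous_X_pow i _⟩

theorem schubert_ne_zero_and_isHomogeneous {w : Equiv.Perm ℕ} (hw : IsFinPerm w) :
    Schubert w ≠ 0 ∧ (Schubert w).IsHomogeneous (rothe w).ncard := by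
  induction hm : (rothe w).ncard using Nat.strong_induction_on generalizing w with
  | _ m ih =>
    by_cases h1 : w = 1
    · subst h1
      rw [rothe_one, Set.ncard_empty] at hm
      rw [schubert_one, ← hm]
      exact ⟨one_ne_zero, isHomogeneous_one _ _⟩
    obtain ⟨j, hj⟩ := exists_descent h1
    have hlen := ncard_rothe_of_descent hw hj
    obtain ⟨hne, hhom⟩ := ih _ (by omega) (hw.mul_swap j (j + 1)) rfl
    rw [← divDiff_schubert_of_descent hw hj] at hne hhom
    obtain ⟨n, hn⟩ := hw
    obtain ⟨d, hd⟩ := exists_isHomogeneous_schubertIn hn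
    rw [← schubert_eq_schubertIn hn] at hd
    have hd0 : d ≠ 0 := by
      rintro rfl
      exact hne (divDiff_of_isHomogeneous_zero hd)
    have := (isHomogeneous_divDiff hd).inj_right hhom hne
    refine ⟨fun h => hne ?_, ?_⟩
    · rw [h, ← C_0, divDiff_C, C_0]
    · rwa [show m = d by omega]

/-- The linear functional extracting the coefficient of `Schubert w`, with its degree and its
values on the covers of `w` (the dual form of Monk's rule). -/
theorem exists_schubert_dual {w : Equiv.Perm ℕ} (hw : IsFinPerm w) :
    ∃ φ : MvPolynomial ℕ ℤ →ₗ[ℤ] ℤ,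
      (∀ v, IsFinPerm v → φ (Schubert v) = if v = w then 1 else 0) ∧
      (∀ d f, f.IsHomogeneous d → d ≠ (rothe w).ncard → φ f = 0) ∧
      ∀ a b, IsBruhatCover w a b → (rothe (w * Equiv.swap a b)).ncard + 1 = (rothe w).ncard ∧
        ∀ k, φ (X k * Schubert (w * Equiv.swap a b)) =
          (if k = a then 1 else 0) - (if k = b then 1 else 0) := by
  induction hm : (rothe w).ncard using Nat.strong_induction_on generalizing w with
  | _ m ih =>
    by_cases h1 : w = 1
    · subst h1
      rw [rothe_one, Set.ncard_empty] at hm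
      subst hm
      refine ⟨lcoeff ℤ 0, fun v hv => ?_, fun d f hf hd => ?_, ?_⟩
      · rw [lcoeff_apply]
        split_ifs with h
        · rw [h, schubert_one, coeff_zero_one]
        · obtain ⟨j, hj⟩ := exists_descent h
          have := ncard_rothe_of_descent hv hj
          refine (schubert_ne_zero_and_isHomogeneous hv).2.coeff_eq_zero ?_
          rw [map_zero]
          omega
      · exact hf.coeff_eq_zero (by rw [map_zero]; exact hd.symm)
      · rintro a b ⟨hab, hlt, -⟩
        simp only [Equiv.Perm.one_apply] at hlt
        omega
    obtain ⟨j, hj⟩ := exists_descent h1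
    have hlen := ncard_rothe_of_descent hw hj
    have hws := hw.mul_swap j (j + 1)
    obtain ⟨φ, hφ1, hφ2, hφ3⟩ := ih _ (by omega) hws rfl
    have hφ1' : ∀ v, IsFinPerm v → φ (divDiff j (Schubert v)) = if v = w then 1 else 0 := by
      intro v hv
      rcases lt_or_gt_of_ne (show v j ≠ v (j + 1) from fun h => by simpa using v.injective h)
        with h | h
      · rw [divDiff_schubert_of_ascent hv h, map_zero, if_neg]
        rintro rfl
        omega
      · rw [divDiff_schubert_of_descent hv h, hφ1 _ (hv.mul_swap _ _)]
        simp only [mul_left_inj]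
    refine ⟨φ.comp (divDiffLin j), hφ1', fun d f hf hd => ?_, fun a b hab => ?_⟩
    · change φ (divDiff j f) = 0
      rcases Nat.eq_zero_or_pos d with rfl | hpos
      · rw [divDiff_of_isHomogeneous_zero hf, map_zero]
      · exact hφ2 _ _ (isHomogeneous_divDiff hf) (by omega)
    · have hX : ∀ k, (φ.comp (divDiffLin j)) (X k * Schubert (w * Equiv.swap a b)) =
          ((if k = j then 1 else 0) - (if k = j + 1 then 1 else 0)) *
            φ (Schubert (w * Equiv.swap a b)) +
          φ (X (Equiv.swap j (j + 1) k) * divDiff j (Schubert (w * Equiv.swap a b))) := by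
        intro k
        change φ (divDiff j _) = _
        rw [divDiff_mul, divDiff_X, rename_X, map_add, ← smul_eq_C_mul, map_smul, smul_eq_mul]
      by_cases hne : a = j ∧ b = j + 1
      · obtain ⟨rfl, rfl⟩ := hne
        refine ⟨by omega, fun k => ?_⟩
        rw [hX, hφ1 _ hws, if_pos rfl, divDiff_schubert_of_ascent hws (by simpa using hj)]
        simp
      · obtain ⟨hl, hk⟩ := hφ3 _ _ (hab.mul_swap hj hne)
        have hd := hab.descent hj hne
        have hl' := ncard_rothe_of_descent (hw.mul_swap a b) hd
        rw [mul_swap_mul_swap_conj] at hl'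
        have hne' : w * Equiv.swap a b ≠ w * Equiv.swap j (j + 1) := by
          intro h
          have hjj : (w * Equiv.swap a b) j = (w * Equiv.swap j (j + 1)) j := by rw [h]
          have hjj' : (w * Equiv.swap a b) (j + 1) = (w * Equiv.swap j (j + 1)) (j + 1) := by
            rw [h]
          have := hab.1
          simp only [Equiv.Perm.mul_apply, w.injective.eq_iff, Equiv.swap_apply_left,
            Equiv.swap_apply_right] at hjj hjj'
          simp only [Equiv.swap_apply_def] at hjj hjj'
          grind
        refine ⟨by omega, fun k => ?_⟩
        rw [hX, hφ1 _ (hw.mul_swap _ _), if_neg hne',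
          divDiff_schubert_of_descent (hw.mul_swap _ _) hd, mul_swap_mul_swap_conj, hk]
        simp

theorem isSchubertCoeff_apply {u v w : Equiv.Perm ℕ} {c : Equiv.Perm ℕ →₀ ℕ}
    (hc : IsSchubertCoeff u v c) {φ : MvPolynomial ℕ ℤ →ₗ[ℤ] ℤ}
    (hφ : ∀ v, IsFinPerm v → φ (Schubert v) = if v = w then 1 else 0) :
    (c w : ℤ) = φ (Schubert u * Schubert v) := by
  rw [hc.2, Finsupp.sum, map_sum]
  have : ∀ x ∈ c.support, φ ((c x : MvPolynomial ℕ ℤ) * Schubert x) =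
      if x = w then (c w : ℤ) else 0 := by
    intro x hx
    rw [← nsmul_eq_mul, map_nsmul, hφ x (hc.1 x hx)]
    split_ifs with h
    · simp [h]
    · simp
  rw [Finset.sum_congr rfl this, Finset.sum_ite_eq']
  split_ifs with h
  · rfl
  · simpa using h

/-- Schubert coefficients vanish unless lengths add up. -/
theorem isSchubertCoeff_eq_zero {u v w : Equiv.Perm ℕ} (hu : IsFinPerm u) (hv : IsFinPerm v)
    (hw : IsFinPerm w) (h : (rothe u).ncard + (rothe v).ncard ≠ (rothe w).ncard)
    {c : Equiv.Perm ℕ →₀ ℕ} (hc : IsSchubertCoeff u v c) : c w = 0 := by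
  obtain ⟨φ, h1, h2, -⟩ := exists_schubert_dual hw
  have := isSchubertCoeff_apply hc h1
  rw [h2 _ _ ((schubert_ne_zero_and_isHomogeneous hu).2.mul
    (schubert_ne_zero_and_isHomogeneous hv).2) h] at this
  exact_mod_cast this

theorem ncard_rothe_swap (i : ℕ) : (rothe (Equiv.swap i (i + 1))).ncard = 1 := by
  have := ncard_rothe_of_ascent (w := 1) ⟨0, fun _ _ => rfl⟩ (j := i) (Nat.lt_succ_self i)
  rwa [one_mul, rothe_one, Set.ncard_empty, zero_add] at this

theorem schubert_swap (i : ℕ) :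
    Schubert (Equiv.swap i (i + 1)) = ∑ k ∈ Finset.range (i + 1), X k := by
  have hs := isFinPerm_swap i (i + 1)
  have hdiff : ∀ j, divDiff j (Schubert (Equiv.swap i (i + 1)) -
      ∑ k ∈ Finset.range (i + 1), X k) = 0 := by
    intro j
    have hsub := (divDiffLin j).map_sub (Schubert (Equiv.swap i (i + 1)))
      (∑ k ∈ Finset.range (i + 1), X k)
    rw [map_sum] at hsub
    change divDiff j _ = divDiff j _ - ∑ k ∈ Finset.range (i + 1), divDiff j (X k) at hsub
    simp only [divDiff_X] at hsub
    rw [← map_sum, Finset.sum_sub_distrib, Finset.sum_ite_eq', Finset.sum_ite_eq'] at hsub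
    rw [hsub]
    rcases eq_or_ne j i with rfl | hji
    · rw [divDiff_schubert_of_descent hs (by simp), Equiv.swap_mul_self, schubert_one]
      simp
    · rw [divDiff_schubert_of_ascent hs]
      · simp only [Finset.mem_range]
        split_ifs <;> first | omega | simp
      · simp only [Equiv.swap_apply_def]
        split_ifs <;> omega
  have hhom : (Schubert (Equiv.swap i (i + 1)) -
      ∑ k ∈ Finset.range (i + 1), X k).IsHomogeneous 1 := by
    refine IsHomogeneous.sub ?_ (IsHomogeneous.sum _ _ _ fun k _ => isHomogeneous_X _ _)
    have := (schubert_ne_zero_and_isHomogeneous hs).2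
    rwa [ncard_rothe_swap] at this
  have := eq_C_of_divDiff_eq_zero hdiff
  rw [hhom.coeff_eq_zero (by simp), C_0] at this
  exact sub_eq_zero.1 this

/-- Monk's rule for a single coefficient. -/
theorem isSchubertCoeff_swap_of_cover {w : Equiv.Perm ℕ} (hw : IsFinPerm w) {a b i : ℕ}
    (hab : IsBruhatCover w a b) (hai : a ≤ i) (hib : i < b) {c : Equiv.Perm ℕ →₀ ℕ}
    (hc : IsSchubertCoeff (w * Equiv.swap a b) (Equiv.swap i (i + 1)) c) : c w = 1 := by
  obtain ⟨φ, h1, -, h3⟩ := exists_schubert_dual hw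
  have := isSchubertCoeff_apply hc h1
  rw [schubert_swap, mul_comm, Finset.sum_mul, map_sum,
    Finset.sum_congr rfl fun k _ => (h3 a b hab).2 k, Finset.sum_sub_distrib,
    Finset.sum_ite_eq', Finset.sum_ite_eq', if_pos (by simp; omega),
    if_neg (by simp; omega), sub_zero] at this
  exact_mod_cast this

theorem ncard_rothe_add_one_of_cover {w : Equiv.Perm ℕ} (hw : IsFinPerm w) {a b : ℕ}
    (hab : IsBruhatCover w a b) :
    (rothe (w * Equiv.swap a b)).ncard + 1 = (rothe w).ncard := by
  obtain ⟨_, -, -, h3⟩ := exists_schubert_dual hw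
  exact (h3 a b hab).1

theorem stretchCol_eq_sum (k N : ℕ) (w : Equiv.Perm ℕ) (j : ℕ) :
    stretchCol k N w j = ∑ h ∈ Finset.range j, if h ∈ shadedCols k w then N else 1 := by
  have h1 : {h | h < j ∧ h ∉ shadedCols k w} =
      ((Finset.range j).filter (· ∉ shadedCols k w) : Set ℕ) := by
    ext; simp
  have h2 : {h | h < j ∧ h ∈ shadedCols k w} =
      ((Finset.range j).filter (· ∈ shadedCols k w) : Set ℕ) := by
    ext; simp
  rw [stretchCol, h1, h2, Set.ncard_coe_finset, Set.ncard_coe_finset, Finset.sum_ite]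
  simp only [Finset.sum_const, smul_eq_mul, mul_one]
  ring

theorem stretchCol_add_le (k N : ℕ) (w : Equiv.Perm ℕ) {j j' : ℕ} (h : j < j') :
    stretchCol k N w j + (if j ∈ shadedCols k w then N else 1) ≤ stretchCol k N w j' := by
  rw [stretchCol_eq_sum, stretchCol_eq_sum, ← Finset.sum_range_succ
    (fun h => if h ∈ shadedCols k w then N else 1)]
  exact Finset.sum_le_sum_of_subset (Finset.range_mono h)

/-- The length of a bit scaling: every box in a shaded column counts `N` times. -/
theorem IsBitScale.ncard_rothe {k N : ℕ} {w w' : Equiv.Perm ℕ} (h : IsBitScale k N w w')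
    (hw : IsFinPerm w) {S : Finset (ℕ × ℕ)}
    (hS : ∀ p, p ∈ S ↔ p ∈ rothe w ∧ p.2 ∈ shadedCols k w) :
    (rothe w').ncard + S.card = (rothe w).ncard + N * S.card := by
  set R := (rothe_finite hw).toFinset with hR
  have hmem : ∀ p, p ∈ R ↔ p ∈ rothe w := fun p => by simp [hR]
  set T := R.sigma fun p => Finset.range (if p.2 ∈ shadedCols k w then N else 1) with hT
  have himg : rothe w' = (fun x : (_ : ℕ × ℕ) × ℕ =>
      (x.1.1, stretchCol k N w x.1.2 + x.2)) '' (T : Set ((_ : ℕ × ℕ) × ℕ)) := by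
    rw [h.2]
    ext q
    constructor
    · rintro ⟨p, hp, m, hm, rfl⟩
      exact ⟨⟨p, m⟩, Finset.mem_coe.2 (Finset.mem_sigma.2
        ⟨(hmem p).2 hp, Finset.mem_range.2 hm⟩), rfl⟩
    · rintro ⟨⟨p, m⟩, hx, rfl⟩
      obtain ⟨hp, hm⟩ := Finset.mem_sigma.1 (Finset.mem_coe.1 hx)
      exact ⟨p, (hmem p).1 hp, m, Finset.mem_range.1 hm, rfl⟩
  have hinj : Set.InjOn (fun x : (_ : ℕ × ℕ) × ℕ =>
      (x.1.1, stretchCol k N w x.1.2 + x.2)) (T : Set ((_ : ℕ × ℕ) × ℕ)) := by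
    rintro ⟨⟨r, c⟩, m⟩ hx ⟨⟨r', c'⟩, m'⟩ hx' heq
    have hm := Finset.mem_range.1 (Finset.mem_sigma.1 (Finset.mem_coe.1 hx)).2
    have hm' := Finset.mem_range.1 (Finset.mem_sigma.1 (Finset.mem_coe.1 hx')).2
    simp only [Prod.mk.injEq] at heq hm hm'
    obtain ⟨rfl, heq⟩ := heq
    rcases lt_trichotomy c c' with hc | rfl | hc
    · have := stretchCol_add_le k N w hc
      omega
    · obtain rfl : m = m' := by omega
      rfl
    · have := stretchCol_add_le k N w hc
      omega
  have hcard : (rothe w').ncard = T.card := by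
    rw [himg, hinj.ncard_image, Set.ncard_coe_finset]
  have hR' : (rothe w).ncard = R.card := Set.ncard_eq_toFinset_card _ (rothe_finite hw)
  have hS' : S = R.filter (fun p => p.2 ∈ shadedCols k w) := by
    ext p
    rw [hS, Finset.mem_filter, hmem]
  rw [hcard, hR', hT, Finset.card_sigma]
  simp only [Finset.card_range]
  rw [Finset.sum_ite, ← hS']
  have := Finset.card_filter_add_card_filter_not (s := R) (fun p => p.2 ∈ shadedCols k w)
  rw [← hS'] at this
  simp only [Finset.sum_const, smul_eq_mul, mul_one]
  rw [mul_comm N]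
  omega

/-- Corollary 4.2: for `u` with `u(i) = n−2`, `u(n−1) = n`, `u(n) = n−1` (1-indexed values;
here written 0-indexed), `v = s_i`, `w = u·t_{i,n}`, and bit scaling w.r.t. `k = n−1`,
saturation under bit scaling fails. -/
theorem saturation_fails_bit_scaling_special
    (n : ℕ) (u : Equiv.Perm ℕ) (hu : InSymm n u)
    (i : ℕ) (hi : i + 3 < n)
    (h1 : u i = n - 3) (h2 : u (n - 2) = n - 1) (h3 : u (n - 1) = n - 2) :
    (∀ c : Equiv.Perm ℕ →₀ ℕ, IsSchubertCoeff u (Equiv.swap i (i + 1)) c →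
      c (u * Equiv.swap i (n - 1)) = 1) ∧
    (∀ N : ℕ, 1 < N → ∀ u' v' w' : Equiv.Perm ℕ,
      IsBitScale (n - 2) N u u' → IsBitScale (n - 2) N (Equiv.swap i (i + 1)) v' →
      IsBitScale (n - 2) N (u * Equiv.swap i (n - 1)) w' →
      ∀ c : Equiv.Perm ℕ →₀ ℕ, IsSchubertCoeff u' v' c → c w' = 0) := by
  set w := u * Equiv.swap i (n - 1) with hw
  have hwS : InSymm n w := hu.mul_swap (by omega) (by omega)
  have hwi : w i = n - 2 := by rw [hw, Equiv.Perm.mul_apply, Equiv.swap_apply_left, h3]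
  have hwn : w (n - 1) = n - 3 := by rw [hw, Equiv.Perm.mul_apply, Equiv.swap_apply_right, h1]
  have hwn2 : w (n - 2) = n - 1 := by
    rw [hw, Equiv.Perm.mul_apply, Equiv.swap_apply_of_ne_of_ne (by omega) (by omega), h2]
  have hcov : IsBruhatCover w i (n - 1) := ⟨by omega, by omega, fun c _ _ => by omega⟩
  have hwu : w * Equiv.swap i (n - 1) = u := by
    rw [hw, mul_assoc, Equiv.swap_mul_self, mul_one]
  refine ⟨fun c hc => ?_, fun N hN u' v' w' hu' hv' hw' c hc => ?_⟩
  · rw [← hwu] at hc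
    exact isSchubertCoeff_swap_of_cover ⟨n, hwS⟩ hcov le_rfl (by omega) hc
  refine isSchubertCoeff_eq_zero hu'.1 hv'.1 hw'.1 ?_ hc
  have hlen := ncard_rothe_add_one_of_cover ⟨n, hwS⟩ hcov
  rw [hwu] at hlen
  have hshade : ∀ x : Equiv.Perm ℕ, InSymm n x → ∀ r c,
      ((r, c) ∈ rothe x ∧ c ∈ shadedCols (n - 2) x) ↔
        (c = x (n - 1) ∧ r < n - 1 ∧ x (n - 1) < x r) := by
    intro x hx r c
    constructor
    · rintro ⟨hp, d, hd, rfl⟩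
      rw [mem_rothe_apply] at hp
      have := mem_rothe_apply.2 hp
      have hrn := rothe_subset hx this
      simp only [Finset.coe_product, Finset.coe_range, Set.mem_prod, Set.mem_Iio] at hrn
      obtain rfl : d = n - 1 := by
        by_contra hne
        have := hx d (by omega)
        omega
      exact ⟨rfl, hp.2, hp.1⟩
    · rintro ⟨rfl, h4, h5⟩
      exact ⟨mem_rothe_apply.2 ⟨h5, h4⟩, n - 1, by omega, rfl⟩
  have eu := hu'.ncard_rothe ⟨n, hu⟩ (S := {(n - 2, n - 2)}) (by
    rintro ⟨r, c⟩
    rw [hshade u hu, h3, Finset.mem_singleton, Prod.mk.injEq]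
    constructor
    · rintro ⟨rfl, rfl⟩
      omega
    · rintro ⟨rfl, h4, h5⟩
      have := hu.lt (show r < n by omega)
      exact ⟨u.injective (by omega), rfl⟩)
  have ev := hv'.ncard_rothe (isFinPerm_swap _ _) (S := ∅) (by
    rintro ⟨r, c⟩
    rw [hshade _ (fun m hm => Equiv.swap_apply_of_ne_of_ne (by omega) (by omega)),
      Equiv.swap_apply_of_ne_of_ne (by omega) (by omega)]
    simp only [Finset.notMem_empty, false_iff, Equiv.swap_apply_def]
    split_ifs <;> omega)
  have ew := hw'.ncard_rothe ⟨n, hwS⟩ (S := {(i, n - 3), (n - 2, n - 3)}) (by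
    rintro ⟨r, c⟩
    rw [hshade w hwS, hwn, Finset.mem_insert, Finset.mem_singleton, Prod.mk.injEq,
      Prod.mk.injEq]
    constructor
    · rintro (⟨rfl, rfl⟩ | ⟨rfl, rfl⟩) <;> omega
    · rintro ⟨rfl, h4, h5⟩
      have := hwS.lt (show r < n by omega)
      rcases (show w r = n - 2 ∨ w r = n - 1 by omega) with h | h
      · exact Or.inl ⟨w.injective (by omega), rfl⟩
      · exact Or.inr ⟨w.injective (by omega), rfl⟩)
  rw [ncard_rothe_swap] at ev
  rw [Finset.card_pair (by simp; omega)] at ew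
  rw [Finset.card_singleton] at eu
  rw [Finset.card_empty] at ev
  omega
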